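/- (Factorization of the spatially smoothed channel matrix, Appendix A.) Let K_5, L_5 ≥ 1 and M_5 = K_5 + L_5 − 1. Let B_n ∈ ℂ^{N_n×L} for n = 1,…,4, let ω_{1,5},…,ω_{L,5} ∈ ℝ, let A_5^{(M)} denote the M×L Vandermonde matrix with these frequencies, and let γ ∈ ℂ^L. Define h = (B_1 ⊙ B_2 ⊙ B_3 ⊙ B_4 ⊙ A_5^{(M_5)}) γ and let H ∈ ℂ^{N_1N_2N_3N_4K_5 × L_5} be the matrix whose ℓ-th column is (I_{N_1} ⊗ I_{N_2} ⊗ I_{N_3} ⊗ I_{N_4} ⊗ J_ℓ) h, where J_ℓ = [0_{K_5×(ℓ−1)}, I_{K_5}, 0_{K_5×(L_5−ℓ)}]. Then H = P · Diag(γ) · Gᵀ, where P = B_1 ⊙ B_2 ⊙ B_3 ⊙ B_4 ⊙ A_5^{(K_5)} and G = A_5^{(L_5)}. -/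

import Mathlib

open Matrix Complex
open scoped Kronecker

/-- The steering vector `a^{(M)}(ω) ∈ ℂ^M`, with `m`-th entry `exp(i m ω)` (0-based `m`). -/
noncomputable def steer (M : ℕ) (ω : ℝ) : Fin M → ℂ :=
  fun m => Complex.exp (Complex.I * (m : ℕ) * (ω : ℂ))

/-- The Vandermonde matrix `A^{(M)} ∈ ℂ^{M×L}` whose `l`-th column is `a^{(M)}(ω l)`. -/
noncomputable def vand (M L : ℕ) (ω : Fin L → ℝ) : Matrix (Fin M) (Fin L) ℂ :=
  Matrix.of fun m l => steer M (ω l) m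

/-- The Khatri–Rao (column-wise Kronecker) product. -/
def khatriRao {m n L : Type*} (A : Matrix m L ℂ) (B : Matrix n L ℂ) :
    Matrix (m × n) L ℂ :=
  Matrix.of fun p l => A p.1 l * B p.2 l

/-- Five-factor Khatri–Rao product (iterated, lexicographic index ordering). -/
def kr5 {N1 N2 N3 N4 N5 L : Type*} (B1 : Matrix N1 L ℂ) (B2 : Matrix N2 L ℂ)
    (B3 : Matrix N3 L ℂ) (B4 : Matrix N4 L ℂ) (B5 : Matrix N5 L ℂ) :
    Matrix (N1 × N2 × N3 × N4 × N5) L ℂ :=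
  khatriRao B1 (khatriRao B2 (khatriRao B3 (khatriRao B4 B5)))

/-- Mixed-product rule for the Kronecker and Khatri–Rao products. -/
theorem kronecker_mul_khatriRao {m n p q L : Type*} [Fintype p] [Fintype q]
    (A : Matrix m p ℂ) (C : Matrix n q ℂ) (P : Matrix p L ℂ) (Q : Matrix q L ℂ) :
    (A ⊗ₖ C) * khatriRao P Q = khatriRao (A * P) (C * Q) := by
  ext ⟨i, j⟩ l
  simp only [khatriRao, Matrix.mul_apply, Matrix.of_apply, Matrix.kroneckerMap_apply,
    Fintype.sum_prod_type, Finset.sum_mul_sum]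
  exact Finset.sum_congr rfl fun _ _ => Finset.sum_congr rfl fun _ _ => by ring

/-- Selecting `K` consecutive rows of a Vandermonde matrix, starting at row `s`, multiplies
its columns by the corresponding phases. -/
theorem selection_mul_vand_apply {K M L s : ℕ} (hs : s + K ≤ M) (ω : Fin L → ℝ)
    (i : Fin K) (l : Fin L) :
    ((Matrix.of fun (i : Fin K) (j : Fin M) =>
      if (j : ℕ) = s + (i : ℕ) then (1 : ℂ) else 0) * vand M L ω) i l =
      vand K L ω i l * Complex.exp (Complex.I * s * (ω l : ℂ)) := by
  have hi : s + (i : ℕ) < M := by omega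
  rw [Matrix.mul_apply, Finset.sum_eq_single ⟨s + i, hi⟩]
  · simp only [vand, steer, Matrix.of_apply, if_true, one_mul, ← Complex.exp_add]
    push_cast
    ring_nf
  · intro j _ hj
    have : (j : ℕ) ≠ s + i := fun e => hj (Fin.ext e)
    simp [this]
  · simp

/-- Factorization of the spatially smoothed channel matrix (Appendix A):
`H = P · Diag(γ) · Gᵀ` with `P = B₁ ⊙ B₂ ⊙ B₃ ⊙ B₄ ⊙ A₅^{(K₅)}` and `G = A₅^{(L₅)}`. -/
theorem stmt6 (K5 L5 M5 L N1 N2 N3 N4 : ℕ) (hK : 1 ≤ K5) (hL : 1 ≤ L5)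
    (hM : M5 = K5 + L5 - 1)
    (B1 : Matrix (Fin N1) (Fin L) ℂ) (B2 : Matrix (Fin N2) (Fin L) ℂ)
    (B3 : Matrix (Fin N3) (Fin L) ℂ) (B4 : Matrix (Fin N4) (Fin L) ℂ)
    (ω5 : Fin L → ℝ) (γ : Fin L → ℂ)
    (h : (Fin N1 × Fin N2 × Fin N3 × Fin N4 × Fin M5) → ℂ)
    (hh : h = kr5 B1 B2 B3 B4 (vand M5 L ω5) *ᵥ γ)
    (H : Matrix (Fin N1 × Fin N2 × Fin N3 × Fin N4 × Fin K5) (Fin L5) ℂ)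
    (hH : ∀ (ℓ : Fin L5) r, H r ℓ =
      (((1 : Matrix (Fin N1) (Fin N1) ℂ) ⊗ₖ ((1 : Matrix (Fin N2) (Fin N2) ℂ) ⊗ₖ
          ((1 : Matrix (Fin N3) (Fin N3) ℂ) ⊗ₖ ((1 : Matrix (Fin N4) (Fin N4) ℂ) ⊗ₖ
            (Matrix.of fun (i : Fin K5) (j : Fin M5) =>
              if (j : ℕ) = (ℓ : ℕ) + (i : ℕ) then (1 : ℂ) else 0))))) *ᵥ h) r) :
    H = kr5 B1 B2 B3 B4 (vand K5 L ω5) * Matrix.diagonal γ * (vand L5 L ω5)ᵀ := by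
  subst hh
  ext ⟨i1, i2, i3, i4, i⟩ ℓ
  have hs : (ℓ : ℕ) + K5 ≤ M5 := by omega
  rw [hH, Matrix.mulVec_mulVec]
  simp only [kr5, kronecker_mul_khatriRao, Matrix.one_mul]
  rw [Matrix.mul_apply, Matrix.mulVec_eq_sum, Finset.sum_apply]
  refine Finset.sum_congr rfl fun l _ => ?_
  simp only [khatriRao, Matrix.of_apply, Matrix.mul_diagonal, Matrix.transpose_apply,
    Pi.smul_apply, MulOpposite.smul_eq_mul_unop, MulOpposite.unop_op,
    selection_mul_vand_apply hs]
  simp only [vand, steer, Matrix.of_apply]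
  ring
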